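/- arXiv:1705.08067 — 3 statements merged into one kernel-verified Lean document; each statement's English description precedes it below -/
import Mathlib

section
/- Let w ≥ 1, let z_1,…,z_w be complex numbers, let p ∈ ℕ, a_p ∈ ℂ with a_p ≠ 0, and let n, m be integers with 0 ≤ m ≤ n. Let ρ = (ρ_1 < … < ρ_m) and σ = (σ_1 < … < σ_m) be strictly increasing tuples with entries in {1,…,n}, let d = n − m, and let ξ = (ξ_1 < … < ξ_d), η = (η_1 < … < η_d) be the complements of ρ and σ in {1,…,n}. Then det(T_n(a)_{ρ,σ}) = (−1)^{pm + |ρ| + |σ|} · a_p^m · s_{(m^p, rev(ξ − id_d)) / rev(η − id_d)}(z_1,…,z_w), where the partitions are λ = (m,…,m [p times], ξ_d − d, ξ_{d−1} − (d−1), …, ξ_1 − 1) and μ = (η_d − d, …, η_1 − 1). -/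
open scoped BigOperators

/-- The `r`-th elementary symmetric polynomial in `w` variables, evaluated at `z`,
extended by `0` to negative integer indices (and automatically `0` for `r > w`). -/
noncomputable def eInt (w : ℕ) (z : Fin w → ℂ) (r : ℤ) : ℂ :=
  if 0 ≤ r then
    ∑ s ∈ Finset.powersetCard r.toNat (Finset.univ : Finset (Fin w)), ∏ i ∈ s, z i
  else 0

/-- The `r`-th complete homogeneous symmetric polynomial in `w` variables, evaluated at `z`,
extended by `0` to negative integer indices. -/
noncomputable def hInt (w : ℕ) (z : Fin w → ℂ) (r : ℤ) : ℂ :=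
  if 0 ≤ r then ∑ m : Sym (Fin w) r.toNat, (m.1.map z).prod else 0

/-- Skew Schur polynomial via the Jacobi–Trudi determinant
`s_{λ/μ} = det [h_{λ_j - μ_k - j + k}]_{j,k=1}^{ℓ}`,
where the parts are given as `1`-based integer sequences `lam`, `mu`. -/
noncomputable def skewSchur (w : ℕ) (z : Fin w → ℂ) (ℓ : ℕ) (lam mu : ℕ → ℤ) : ℂ :=
  Matrix.det (Matrix.of fun j k : Fin ℓ =>
    hInt w z (lam (j.1 + 1) - mu (k.1 + 1) - ((j.1 : ℤ) + 1) + ((k.1 : ℤ) + 1)))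

/-- Schur polynomial `s_λ`. -/
noncomputable def schur (w : ℕ) (z : Fin w → ℂ) (ℓ : ℕ) (lam : ℕ → ℤ) : ℂ :=
  skewSchur w z ℓ lam (fun _ => 0)

/-- Coefficients of the Laurent polynomial `a(t) = a_p t^(p-w) ∏_{j=1}^w (t - z_j)`,
namely `a_k = (-1)^(p-k) * a_p * e_{p-k}(z_1,…,z_w)`. -/
noncomputable def aCoeff (w p : ℕ) (ap : ℂ) (z : Fin w → ℂ) (k : ℤ) : ℂ :=
  (-1 : ℂ) ^ ((p : ℤ) - k) * ap * eInt w z ((p : ℤ) - k)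

/-- The `n × n` Toeplitz matrix `[a_{j-k}]_{j,k=1}^n` with coefficient sequence `a`. -/
noncomputable def toeplitz (n : ℕ) (a : ℤ → ℂ) : Matrix (Fin n) (Fin n) ℂ :=
  Matrix.of fun j k => a ((j.1 : ℤ) - (k.1 : ℤ))

section PowerSeriesToeplitz

open PowerSeries

/-- The upper triangular Toeplitz matrix built from the coefficients of a power series. -/
noncomputable def upperToeplitz {R : Type*} [CommRing R] (N : ℕ) (f : R⟦X⟧) :
    Matrix (Fin N) (Fin N) R :=
  Matrix.of fun i j => if i ≤ j then coeff (j.1 - i.1) f else 0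

theorem upperToeplitz_mul {R : Type*} [CommRing R] (N : ℕ) (f g : R⟦X⟧) :
    upperToeplitz N f * upperToeplitz N g = upperToeplitz N (f * g) := by
  ext i j
  simp only [upperToeplitz, Matrix.mul_apply, Matrix.of_apply, Fin.le_def]
  rw [Fin.sum_univ_eq_sum_range (fun k => (if i.1 ≤ k then coeff (k - i.1) f else 0) *
    (if k ≤ j.1 then coeff (j.1 - k) g else 0)) N]
  have hsub : Finset.Ico i.1 (j.1 + 1) ⊆ Finset.range N := by
    intro k hk
    simp only [Finset.mem_Ico, Finset.mem_range] at hk ⊢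
    omega
  rw [← Finset.sum_subset hsub]
  · rw [Finset.sum_Ico_eq_sum_range]
    split_ifs with hij
    · rw [coeff_mul, Finset.Nat.sum_antidiagonal_eq_sum_range_succ_mk,
        show j.1 + 1 - i.1 = (j.1 - i.1).succ by omega]
      refine Finset.sum_congr rfl fun k hk => ?_
      rw [Finset.mem_range] at hk
      rw [if_pos (by omega), if_pos (by omega), Nat.add_sub_cancel_left, Nat.sub_sub]
    · rw [show j.1 + 1 - i.1 = 0 by omega, Finset.sum_range_zero]
  · intro k _ hk
    simp only [Finset.mem_Ico, not_and_or] at hk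
    rcases hk with hk | hk
    · rw [if_neg hk, zero_mul]
    · rw [if_neg (by omega : ¬ k ≤ j.1), mul_zero]

theorem det_upperToeplitz {R : Type*} [CommRing R] (N : ℕ) (f : R⟦X⟧) :
    (upperToeplitz N f).det = constantCoeff f ^ N := by
  rw [Matrix.det_of_isUpperTriangular]
  · simp [upperToeplitz]
  · intro i j hij
    exact if_neg (not_le.mpr hij)

theorem upperToeplitz_one {R : Type*} [CommRing R] (N : ℕ) :
    upperToeplitz N (1 : R⟦X⟧) = 1 := by
  ext i j
  simp only [upperToeplitz, Matrix.of_apply, Matrix.one_apply, coeff_one, Fin.le_def, Fin.ext_iff]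
  split_ifs <;> first | rfl | omega

theorem coeff_prod_one_sub {w : ℕ} (z : Fin w → ℂ) (r : ℕ) :
    coeff r (∏ i, (1 - C (z i) * X)) = (-1) ^ r * eInt w z r := by
  have h : ∀ i, (1 - C (z i) * X : ℂ⟦X⟧) = 1 + C (-z i) * X := fun i => by
    rw [map_neg, neg_mul, sub_eq_add_neg]
  simp_rw [h, Finset.prod_one_add, Finset.prod_mul_distrib, Finset.prod_const, ← map_prod,
    map_sum, coeff_C_mul, coeff_X_pow, Finset.prod_neg, mul_ite, mul_one, mul_zero]
  rw [← Finset.sum_filter, eInt, if_pos (Int.natCast_nonneg r), Int.toNat_natCast, Finset.mul_sum]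
  refine Finset.sum_congr ?_ fun s hs => ?_
  · ext s
    simp [Finset.mem_powersetCard, eq_comm]
  · rw [(Finset.mem_powersetCard.mp hs).2]

theorem coeff_prod_mk_pow {w : ℕ} (z : Fin w → ℂ) (r : ℕ) :
    coeff r (∏ i, mk fun k => z i ^ k) = hInt w z r := by
  rw [coeff_prod, hInt, if_pos (Int.natCast_nonneg r), Int.toNat_natCast]
  simp only [coeff_mk]
  refine Finset.sum_bij' (fun l hl => (Sym.equivNatSum (Fin w) r).symm
      ⟨l, (Finset.mem_finsuppAntidiag'.mp hl).1⟩)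
    (fun s _ => (Sym.equivNatSum (Fin w) r s).1) ?_ ?_ ?_ ?_ ?_
  · simp
  · intro s _
    exact Finset.mem_finsuppAntidiag'.mpr ⟨(Sym.equivNatSum (Fin w) r s).2, Finset.subset_univ _⟩
  · intro l hl
    simp
  · intro s hs
    simp
  · intro l hl
    have : ((Sym.equivNatSum (Fin w) r).symm
      ⟨l, (Finset.mem_finsuppAntidiag'.mp hl).1⟩).1 = Finsupp.toMultiset l := rfl
    rw [this, Finsupp.toMultiset_map, Finsupp.prod_toMultiset, Finsupp.prod_mapDomain_index
      (by simp) (by simp [pow_add]), Finsupp.prod_fintype _ _ (by simp)]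

theorem prod_one_sub_mul_prod_mk_pow {ι R : Type*} [CommRing R] (s : Finset ι) (z : ι → R) :
    (∏ i ∈ s, (1 - C (z i) * X)) * ∏ i ∈ s, (mk fun k => z i ^ k) = (1 : R⟦X⟧) := by
  rw [← Finset.prod_mul_distrib]
  refine Finset.prod_eq_one fun i _ => ?_
  ext k
  cases k with
  | zero => simp [sub_mul]
  | succ k =>
    simp [sub_mul, mul_assoc, coeff_succ_X_mul, pow_succ', coeff_one]

theorem eInt_of_neg {w : ℕ} (z : Fin w → ℂ) {r : ℤ} (hr : r < 0) : eInt w z r = 0 :=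
  if_neg (not_le.mpr hr)

theorem hInt_of_neg {w : ℕ} (z : Fin w → ℂ) {r : ℤ} (hr : r < 0) : hInt w z r = 0 :=
  if_neg (not_le.mpr hr)

theorem upperToeplitz_prod_one_sub_apply {w : ℕ} (z : Fin w → ℂ) (N : ℕ) (i j : Fin N) :
    upperToeplitz N (∏ i, (1 - C (z i) * X)) i j =
      (-1) ^ ((j : ℤ) - (i : ℤ)) * eInt w z ((j : ℤ) - (i : ℤ)) := by
  rw [upperToeplitz, Matrix.of_apply]
  split_ifs with hij
  · rw [coeff_prod_one_sub, ← Nat.cast_sub hij, zpow_natCast]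
  · rw [eInt_of_neg z (by rw [Fin.le_def] at hij; omega), mul_zero]

theorem upperToeplitz_prod_mk_pow_apply {w : ℕ} (z : Fin w → ℂ) (N : ℕ) (i j : Fin N) :
    upperToeplitz N (∏ i, mk fun k => z i ^ k) i j = hInt w z ((j : ℤ) - (i : ℤ)) := by
  rw [upperToeplitz, Matrix.of_apply]
  split_ifs with hij
  · rw [coeff_prod_mk_pow, ← Nat.cast_sub hij]
  · rw [hInt_of_neg z (by rw [Fin.le_def] at hij; omega)]

end PowerSeriesToeplitz

/-- The sign of the permutation that lists two complementary increasing sequences one after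
the other. -/
theorem sign_of_strictMono_of_strictMono {m q : ℕ} (π : Equiv.Perm (Fin (m + q)))
    (hl : StrictMono fun i => π (Fin.castAdd q i)) (hr : StrictMono fun i => π (Fin.natAdd m i)) :
    Equiv.Perm.sign π = ∏ i : Fin m, (-1) ^ ((π (Fin.castAdd q i) : ℕ) + (i : ℕ)) := by
  have key : ∀ i, ∏ j ∈ Finset.Ioi i, (if π i < π j then (1 : ℤˣ) else -1) =
      ∏ j, if i < j then (if π i < π j then (1 : ℤˣ) else -1) else 1 := fun i => by
    rw [← Finset.prod_filter]
    congr 1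
    ext j
    simp
  have hlow : ∀ {k : ℕ} (y : Fin k), ∏ x : Fin k, (if x < y then (-1 : ℤˣ) else 1) =
      (-1) ^ (y : ℕ) := fun y => by
    rw [← Finset.prod_filter, Finset.prod_const, ← Fin.card_Iio]
    congr 2
    ext x
    simp
  rw [Equiv.Perm.sign_eq_prod_prod_Ioi]
  simp_rw [key]
  rw [Fin.prod_univ_add]
  have hright : ∀ i : Fin q, (∏ j, if Fin.natAdd m i < j then
      (if π (Fin.natAdd m i) < π j then (1 : ℤˣ) else -1) else 1) = 1 := fun i => by
    refine Finset.prod_eq_one fun j _ => ?_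
    induction j using Fin.addCases with
    | left j => exact if_neg (by simp only [Fin.lt_def, Fin.val_natAdd, Fin.val_castAdd]; omega)
    | right j =>
      split_ifs with h1 h2
      · rfl
      · exact absurd (hr (by simpa using h1)) h2
      · rfl
  rw [Finset.prod_eq_one (fun i _ => hright i), mul_one]
  refine Finset.prod_congr rfl fun i _ => ?_
  have htot := hlow (π (Fin.castAdd q i))
  rw [← Equiv.prod_comp π, Fin.prod_univ_add] at htot
  simp_rw [hl.lt_iff_lt] at htot
  rw [hlow i] at htot
  rw [pow_add, ← htot, Fin.prod_univ_add, mul_right_comm, ← mul_pow, neg_one_mul, neg_neg,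
    one_pow, one_mul, Finset.prod_eq_one, one_mul]
  · refine Finset.prod_congr rfl fun j _ => ?_
    rw [if_pos (by simp only [Fin.lt_def, Fin.val_natAdd, Fin.val_castAdd]; omega)]
    have hne : π (Fin.castAdd q i) ≠ π (Fin.natAdd m j) := fun h => by
      have := congrArg Fin.val (π.injective h)
      simp only [Fin.val_natAdd, Fin.val_castAdd] at this
      omega
    split_ifs with h1 h2 h2
    · exact absurd h1 h2.asymm
    · rfl
    · rfl
    · exact absurd (le_antisymm (not_lt.mp h2) (not_lt.mp h1)) hne
  · intro j _
    split_ifs with h1 h2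
    · rfl
    · exact absurd (hl ((Fin.strictMono_castAdd q).lt_iff_lt.mp h1)) h2
    · rfl

/-- Two complementary strictly increasing sequences enumerate the whole index set. -/
theorem exists_equiv_sumElim {m q : ℕ} {r : Fin m → Fin (m + q)} {c : Fin q → Fin (m + q)}
    (hr : StrictMono r) (hc : StrictMono c) (hd : ∀ i j, r i ≠ c j) :
    ∃ e : Fin m ⊕ Fin q ≃ Fin (m + q), (e : Fin m ⊕ Fin q → Fin (m + q)) = Sum.elim r c ∧
      Equiv.Perm.sign (finSumFinEquiv.symm.trans e) =
        ∏ i : Fin m, (-1) ^ ((r i : ℕ) + (i : ℕ)) := by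
  have hinj : Function.Injective (Sum.elim r c) := hr.injective.sumElim hc.injective hd
  have hbij : Function.Bijective (Sum.elim r c) :=
    (Fintype.bijective_iff_injective_and_card _).mpr ⟨hinj, by simp⟩
  refine ⟨Equiv.ofBijective _ hbij, rfl, ?_⟩
  rw [sign_of_strictMono_of_strictMono]
  · simp
  · simpa using hr
  · simpa using hc

/-- Jacobi's complementary minor theorem. -/
theorem det_submatrix_of_mul_eq_one {R : Type*} [CommRing R] {m q : ℕ}
    {A B : Matrix (Fin (m + q)) (Fin (m + q)) R} (hAB : A * B = 1)
    {r s : Fin m → Fin (m + q)} {r' s' : Fin q → Fin (m + q)}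
    (hr : StrictMono r) (hr' : StrictMono r') (hd : ∀ i j, r i ≠ r' j)
    (hs : StrictMono s) (hs' : StrictMono s') (hd' : ∀ i j, s i ≠ s' j) :
    (A.submatrix r s).det =
      (-1) ^ (∑ i, ((r i : ℕ) + (s i : ℕ))) * A.det * (B.submatrix s' r').det := by
  obtain ⟨e, he, hes⟩ := exists_equiv_sumElim hr hr' hd
  obtain ⟨f, hf, hfs⟩ := exists_equiv_sumElim hs hs' hd'
  have hmul : A.submatrix e f * B.submatrix f e = 1 := by
    rw [Matrix.submatrix_mul_equiv, hAB, Matrix.submatrix_one_equiv]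
  have hblock : A.submatrix e f *
      Matrix.fromBlocks 1 (B.submatrix s r') 0 (B.submatrix s' r') =
      Matrix.fromBlocks (A.submatrix r s) 0 (A.submatrix r' s) 1 := by
    rw [he, hf] at hmul ⊢
    have hA : A.submatrix (Sum.elim r r') (Sum.elim s s') = Matrix.fromBlocks
        (A.submatrix r s) (A.submatrix r s') (A.submatrix r' s) (A.submatrix r' s') := by
      ext (i | i) (j | j) <;> rfl
    have hB : B.submatrix (Sum.elim s s') (Sum.elim r r') = Matrix.fromBlocks
        (B.submatrix s r) (B.submatrix s r') (B.submatrix s' r) (B.submatrix s' r') := by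
      ext (i | i) (j | j) <;> rfl
    rw [hA, hB, Matrix.fromBlocks_multiply, ← Matrix.fromBlocks_one, Matrix.fromBlocks_inj] at hmul
    rw [hA, Matrix.fromBlocks_multiply]
    simp [hmul.2.1, hmul.2.2.2]
  have hdet := congrArg Matrix.det hblock
  rw [Matrix.det_mul, Matrix.det_fromBlocks_zero₂₁, Matrix.det_fromBlocks_zero₁₂, Matrix.det_one,
    Matrix.det_one, one_mul, mul_one] at hdet
  rw [← hdet]
  congr 1
  have hperm : (A.submatrix e f).det =
      ((A.submatrix (finSumFinEquiv.symm.trans e) id).submatrix id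
        (finSumFinEquiv.symm.trans f)).det := by
    rw [← Matrix.det_submatrix_equiv_self finSumFinEquiv.symm]
    rfl
  rw [hperm, Matrix.det_permute', Matrix.det_permute, hes, hfs, ← mul_assoc]
  congr 1
  rw [← Int.cast_mul, ← Units.val_mul, ← Finset.prod_mul_distrib, Finset.prod_congr rfl
    (g := fun i => (-1) ^ ((r i : ℕ) + (s i : ℕ))), Finset.prod_pow_eq_pow_sum]
  · simp
  · intro i _
    rw [← pow_add, show (s i : ℕ) + i + ((r i : ℕ) + i) = r i + s i + 2 * i by omega, pow_add,
      pow_mul, neg_one_sq, one_pow, mul_one]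

theorem sum_Icc_one_eq_sum_fin (m : ℕ) (f : ℕ → ℕ) :
    ∑ j ∈ Finset.Icc 1 m, f j = ∑ j : Fin m, f (j + 1) := by
  rw [Fin.sum_univ_eq_sum_range (fun j => f (j + 1)) m, Finset.range_eq_Ico,
    Finset.sum_Ico_add' f 0 m 1]
  rfl

/-- Theorem 1 (eq. 3), formula (eq:main): every minor of a banded Toeplitz matrix is,
up to sign and a power of `a_p`, the skew Schur polynomial
`s_{(m^p, rev(ξ - id_d)) / rev(η - id_d)}` evaluated at the zeros of `a`. -/
theorem toeplitz_minor_eq_skewSchur_main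
    (w : ℕ) (hw : 1 ≤ w) (z : Fin w → ℂ) (p : ℕ) (ap : ℂ) (hap : ap ≠ 0)
    (n m d : ℕ) (hmn : m ≤ n) (hd : d = n - m)
    (ρ σ ξ η : ℕ → ℕ)
    (hρmono : StrictMonoOn ρ (Set.Icc 1 m)) (hσmono : StrictMonoOn σ (Set.Icc 1 m))
    (hξmono : StrictMonoOn ξ (Set.Icc 1 d)) (hηmono : StrictMonoOn η (Set.Icc 1 d))
    (hρran : ρ '' Set.Icc 1 m ⊆ Set.Icc 1 n)
    (hσran : σ '' Set.Icc 1 m ⊆ Set.Icc 1 n)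
    (hξran : ξ '' Set.Icc 1 d = Set.Icc 1 n \ ρ '' Set.Icc 1 m)
    (hηran : η '' Set.Icc 1 d = Set.Icc 1 n \ σ '' Set.Icc 1 m) :
    Matrix.det (Matrix.of fun j k : Fin m =>
        aCoeff w p ap z ((ρ (j.1 + 1) : ℤ) - (σ (k.1 + 1) : ℤ)))
      = (-1 : ℂ) ^ (p * m + (∑ j ∈ Finset.Icc 1 m, ρ j) + ∑ j ∈ Finset.Icc 1 m, σ j)
        * ap ^ m
        * skewSchur w z (p + d)
            (fun j => if j ≤ p then (m : ℤ)
              else (ξ (p + d + 1 - j) : ℤ) - ((p + d + 1 - j : ℕ) : ℤ))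
            (fun k => if k ≤ d then (η (d + 1 - k) : ℤ) - ((d + 1 - k : ℕ) : ℤ) else 0) := by
  obtain rfl : n = m + d := by omega
  clear hd hmn
  have hρ : ∀ j, 1 ≤ j → j ≤ m → 1 ≤ ρ j ∧ ρ j ≤ m + d := fun j h1 h2 =>
    hρran ⟨j, ⟨h1, h2⟩, rfl⟩
  have hσ : ∀ j, 1 ≤ j → j ≤ m → 1 ≤ σ j ∧ σ j ≤ m + d := fun j h1 h2 =>
    hσran ⟨j, ⟨h1, h2⟩, rfl⟩
  have hξ : ∀ j, 1 ≤ j → j ≤ d → (1 ≤ ξ j ∧ ξ j ≤ m + d) ∧ ∀ i, 1 ≤ i → i ≤ m → ρ i ≠ ξ j :=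
    fun j h1 h2 => by
      obtain ⟨h, h'⟩ := hξran.subset ⟨j, ⟨h1, h2⟩, rfl⟩
      exact ⟨h, fun i hi1 hi2 hi => h' ⟨i, ⟨hi1, hi2⟩, hi⟩⟩
  have hη : ∀ j, 1 ≤ j → j ≤ d → (1 ≤ η j ∧ η j ≤ m + d) ∧ ∀ i, 1 ≤ i → i ≤ m → σ i ≠ η j :=
    fun j h1 h2 => by
      obtain ⟨h, h'⟩ := hηran.subset ⟨j, ⟨h1, h2⟩, rfl⟩
      exact ⟨h, fun i hi1 hi2 hi => h' ⟨i, ⟨hi1, hi2⟩, hi⟩⟩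
  let r : Fin m → Fin (m + (d + p)) := fun j => ⟨ρ (j + 1) - 1, by
    have := hρ (j + 1) (by omega) (by omega); omega⟩
  let s : Fin m → Fin (m + (d + p)) := fun j => ⟨σ (j + 1) - 1 + p, by
    have := hσ (j + 1) (by omega) (by omega); omega⟩
  let r' : Fin (d + p) → Fin (m + (d + p)) := fun k =>
    ⟨if (k : ℕ) < d then ξ (k + 1) - 1 else m + k, by
      split_ifs
      · have := (hξ (k + 1) (by omega) (by omega)).1; omega
      · omega⟩
  let s' : Fin (d + p) → Fin (m + (d + p)) := fun k =>
    ⟨if (k : ℕ) < p then k else η (k - p + 1) - 1 + p, by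
      split_ifs
      · omega
      · have := (hη (k - p + 1) (by omega) (by omega)).1; omega⟩
  have hr : StrictMono r := fun i j hij => by
    have h := hρmono (a := i + 1) (b := j + 1) ⟨by omega, by omega⟩ ⟨by omega, by omega⟩
      (by simpa using hij)
    have := hρ (i + 1) (by omega) (by omega)
    simp only [r, Fin.lt_def]
    omega
  have hs : StrictMono s := fun i j hij => by
    have h := hσmono (a := i + 1) (b := j + 1) ⟨by omega, by omega⟩ ⟨by omega, by omega⟩
      (by simpa using hij)
    have := hσ (i + 1) (by omega) (by omega)
    simp only [s, Fin.lt_def]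
    omega
  have hr' : StrictMono r' := fun i j hij => by
    rw [Fin.lt_def] at hij
    simp only [r', Fin.lt_def]
    split_ifs with hi hj hj
    · have h := hξmono (a := i + 1) (b := j + 1) ⟨by omega, by omega⟩ ⟨by omega, by omega⟩
        (by omega)
      have := (hξ (i + 1) (by omega) (by omega)).1
      omega
    · have := (hξ (i + 1) (by omega) (by omega)).1
      omega
    · omega
    · omega
  have hs' : StrictMono s' := fun i j hij => by
    rw [Fin.lt_def] at hij
    simp only [s', Fin.lt_def]
    split_ifs with hi hj hj
    · omega
    · omega
    · omega
    · have h := hηmono (a := i - p + 1) (b := j - p + 1) ⟨by omega, by omega⟩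
        ⟨by omega, by omega⟩ (by omega)
      have := (hη (i - p + 1) (by omega) (by omega)).1
      omega
  have hd : ∀ i j, r i ≠ r' j := fun i j h => by
    have hi := hρ (i + 1) (by omega) (by omega)
    simp only [r, r', Fin.ext_iff] at h
    split_ifs at h with hj
    · have hj' := hξ (j + 1) (by omega) (by omega)
      exact hj'.2 (i + 1) (by omega) (by omega) (by omega)
    · omega
  have hd' : ∀ i j, s i ≠ s' j := fun i j h => by
    have hi := hσ (i + 1) (by omega) (by omega)
    simp only [s, s', Fin.ext_iff] at h
    split_ifs at h with hj
    · omega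
    · have hj' := hη (j - p + 1) (by omega) (by omega)
      exact hj'.2 (i + 1) (by omega) (by omega) (by omega)
  set U := upperToeplitz (m + (d + p)) (∏ i, (1 - PowerSeries.C (z i) * PowerSeries.X)) with hU
  set H := upperToeplitz (m + (d + p)) (∏ i, PowerSeries.mk fun k => z i ^ k) with hH
  have hUH : U * H = 1 := by
    rw [hU, hH, upperToeplitz_mul, prod_one_sub_mul_prod_mk_pow, upperToeplitz_one]
  have hdetU : U.det = 1 := by
    rw [hU, det_upperToeplitz]
    simp
  have hT : (Matrix.of fun j k : Fin m =>
      aCoeff w p ap z ((ρ (j.1 + 1) : ℤ) - (σ (k.1 + 1) : ℤ))) = ap • U.submatrix r s := by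
    ext j k
    have hj := hρ (j + 1) (by omega) (by omega)
    have hk := hσ (k + 1) (by omega) (by omega)
    have hcol : ((s k : ℕ) : ℤ) - ((r j : ℕ) : ℤ) = p - ((ρ (j + 1) : ℤ) - σ (k + 1)) := by
      simp only [r, s]
      omega
    rw [Matrix.smul_apply, Matrix.submatrix_apply, hU, upperToeplitz_prod_one_sub_apply, hcol,
      Matrix.of_apply, aCoeff, smul_eq_mul]
    ring
  have hS : skewSchur w z (p + d)
      (fun j => if j ≤ p then (m : ℤ)
        else (ξ (p + d + 1 - j) : ℤ) - ((p + d + 1 - j : ℕ) : ℤ))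
      (fun k => if k ≤ d then (η (d + 1 - k) : ℤ) - ((d + 1 - k : ℕ) : ℤ) else 0) =
      (H.submatrix s' r').det := by
    rw [skewSchur, ← Matrix.det_transpose (H.submatrix s' r'),
      ← Matrix.det_submatrix_equiv_self (Fin.revPerm.trans (finCongr (Nat.add_comm p d)))]
    congr 1
    ext j k
    rw [Matrix.submatrix_apply, Matrix.transpose_apply, Matrix.submatrix_apply, hH,
      upperToeplitz_prod_mk_pow_apply, Matrix.of_apply]
    congr 1
    simp only [r', s', Equiv.trans_apply, Fin.revPerm_apply, finCongr_apply, Fin.val_cast,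
      Fin.val_rev]
    have hlam : (if (j : ℕ) + 1 ≤ p then (m : ℤ)
        else (ξ (p + d + 1 - (j + 1)) : ℤ) - ((p + d + 1 - (j + 1) : ℕ) : ℤ)) - (j + 1) =
        ((if p + d - (j + 1) < d then ξ (p + d - (j + 1) + 1) - 1
          else m + (p + d - (j + 1)) : ℕ) : ℤ) - (p + d) := by
      split_ifs
      · omega
      · omega
      · have := (hξ (p + d - (j + 1) + 1) (by omega) (by omega)).1
        rw [show p + d + 1 - (j.1 + 1) = p + d - (j + 1) + 1 by omega]
        omega
      · omega
    have hmu : (if (k : ℕ) + 1 ≤ d then (η (d + 1 - (k + 1)) : ℤ) - ((d + 1 - (k + 1) : ℕ) : ℤ)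
        else 0) - (k + 1) =
        ((if p + d - (k + 1) < p then p + d - (k + 1)
          else η (p + d - (k + 1) - p + 1) - 1 + p : ℕ) : ℤ) - (p + d) := by
      split_ifs
      · omega
      · have := (hη (p + d - (k + 1) - p + 1) (by omega) (by omega)).1
        rw [show d + 1 - (k.1 + 1) = p + d - (k + 1) - p + 1 by omega]
        omega
      · omega
      · omega
    linarith
  have hexp : p * m + (∑ j ∈ Finset.Icc 1 m, ρ j) + ∑ j ∈ Finset.Icc 1 m, σ j =
      (∑ i, ((r i : ℕ) + (s i : ℕ))) + 2 * m := by
    have h : ∀ i : Fin m, (r i : ℕ) + s i + 2 = ρ (i + 1) + σ (i + 1) + p := fun i => by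
      have hi := hρ (i + 1) (by omega) (by omega)
      have hi' := hσ (i + 1) (by omega) (by omega)
      simp only [r, s]
      omega
    have hsum := Finset.sum_congr (rfl : (Finset.univ : Finset (Fin m)) = _) fun i _ => h i
    simp only [Finset.sum_add_distrib, Finset.sum_const, Finset.card_univ, Fintype.card_fin,
      smul_eq_mul] at hsum
    rw [sum_Icc_one_eq_sum_fin, sum_Icc_one_eq_sum_fin, Finset.sum_add_distrib]
    linarith
  rw [hT, hS, Matrix.det_smul, Fintype.card_fin,
    det_submatrix_of_mul_eq_one hUH hr hr' hd hs hs' hd', hdetU, hexp, pow_add, pow_mul, neg_one_sq,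
    one_pow]
  ring
end

section
/- Let w ≥ 1, let z_1,…,z_w be complex numbers, let p ∈ ℕ, a_p ∈ ℂ with a_p ≠ 0, and let n ≥ 1. Then for every r, s ∈ {1,…,n}, adj(T_n(a))_{r,s} = (−1)^{p(n−1)} · a_p^{n−1} · s_{((n−1)^p, n−r)/(n−s)}(z_1,…,z_w), where the outer partition is ((n−1) repeated p times, then n−r) and the inner partition is the single part (n−s). -/
open scoped BigOperators

namespace Matrix

/-- **Jacobi's complementary minor identity** for a block of size one less than the
upper left block: if `N` is the inverse of `M`, then an entry of the adjugate of the upper left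
block of `M` is, up to `det N`, the minor of `N` complementary to it. -/
theorem adjugate_toBlocks₁₁_mul_det_of_mul_eq_one {m k R : Type*} [Fintype m] [DecidableEq m]
    [Fintype k] [DecidableEq k] [CommRing R] {M N : Matrix (m ⊕ k) (m ⊕ k) R} (h : M * N = 1)
    (r s : m) :
    M.toBlocks₁₁.adjugate r s * N.det =
      (N.submatrix (fun x : Option k => x.elim (Sum.inl r) Sum.inr)
        (fun x : Option k => x.elim (Sum.inl s) Sum.inr)).det := by
  set K : Matrix (m ⊕ k) (m ⊕ k) R :=
    fromBlocks (M.toBlocks₁₁.updateRow s (Pi.single r 1)) (M.toBlocks₁₂.updateRow s 0) 0 1 with hK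
  have hKdet : K.det = M.toBlocks₁₁.adjugate r s := by
    rw [hK, det_fromBlocks_zero₂₁, det_one, mul_one, adjugate_apply]
  have hKs (y) : (K * N) (Sum.inl s) y = N (Sum.inl r) y := by
    simp [mul_apply, hK, Pi.single_apply]
  have hKi (i y) : (K * N) (Sum.inr i) y = N (Sum.inr i) y := by
    simp [mul_apply, hK, one_apply]
  have hKa (a y) (ha : a ≠ s) :
      (K * N) (Sum.inl a) y = (1 : Matrix (m ⊕ k) (m ⊕ k) R) (Sum.inl a) y := by
    rw [← h]
    simp [mul_apply, hK, updateRow_ne ha, toBlocks₁₁, toBlocks₁₂]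
  let q : m ⊕ k → Prop := Sum.elim (fun a => a = s) fun _ => True
  have : DecidablePred q := Classical.decPred q
  let g : Option k → {x // q x} := fun x =>
    ⟨x.elim (Sum.inl s) Sum.inr, by cases x <;> simp [q]⟩
  have hg : Function.Bijective g := by
    refine ⟨fun x y hxy => ?_, fun ⟨x, hx⟩ => ?_⟩
    · rcases x with _ | x <;> rcases y with _ | y <;> simp_all [g]
    · rcases x with a | i
      · exact ⟨none, by simp [g, show a = s from hx]⟩
      · exact ⟨some i, rfl⟩
  rw [← hKdet, ← det_mul, twoBlockTriangular_det (K * N) q,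
    ← det_submatrix_equiv_self (Equiv.ofBijective g hg)]
  · have h1 : toSquareBlockProp (K * N) (fun i => ¬ q i) = 1 := by
      ext ⟨x, hx⟩ ⟨y, hy⟩
      rcases x with a | i
      · rw [toSquareBlockProp_def, of_apply, hKa a y hx]
        simp [one_apply]
      · simp [q] at hx
    rw [h1, det_one, mul_one]
    congr 1
    ext x y
    rcases x with _ | x <;> simp [toSquareBlockProp_def, g, hKs, hKi]
  · rintro (a | i) hx y hy
    · rw [hKa a y hx, one_apply_ne]
      rintro rfl
      exact hx hy
    · simp [q] at hx

end Matrix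

theorem coe_finRotate_pow_apply {n : ℕ} (p : ℕ) (i : Fin n) :
    (((finRotate n) ^ p) i : ℕ) = (i + p) % n := by
  induction p with
  | zero => simp [Nat.mod_eq_of_lt i.2]
  | succ p ih =>
    cases n with
    | zero => exact i.elim0
    | succ n =>
      rw [pow_succ', Equiv.Perm.mul_apply, finRotate_apply, Fin.val_add, ih, Fin.val_one',
        ← Nat.add_mod, add_assoc]

namespace PowerSeries

variable {R : Type*} [CommRing R]

/-- The coefficients of a power series, extended by `0` to negative integer indices. -/
noncomputable def coeffInt (f : R⟦X⟧) (k : ℤ) : R :=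
  if 0 ≤ k then coeff k.toNat f else 0

theorem coeffInt_natCast (f : R⟦X⟧) (k : ℕ) : coeffInt f k = coeff k f := by
  simp [coeffInt]

theorem coeffInt_of_neg (f : R⟦X⟧) {k : ℤ} (hk : k < 0) : coeffInt f k = 0 := by
  simp [coeffInt, not_le.mpr hk]

/-- The upper triangular Toeplitz matrix of a power series. -/
noncomputable def toeplitzMatrix (N : ℕ) (f : R⟦X⟧) : Matrix (Fin N) (Fin N) R :=
  Matrix.of fun i j => coeffInt f ((j : ℤ) - i)

theorem toeplitzMatrix_mul (N : ℕ) (f g : R⟦X⟧) :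
    toeplitzMatrix N f * toeplitzMatrix N g = toeplitzMatrix N (f * g) := by
  ext i k
  simp only [toeplitzMatrix, Matrix.mul_apply, Matrix.of_apply]
  rcases lt_or_ge k i with hki | hik
  · rw [coeffInt_of_neg _ (by omega)]
    refine Finset.sum_eq_zero fun j _ => ?_
    rcases lt_or_ge j i with hj | hj
    · rw [coeffInt_of_neg f (by omega), zero_mul]
    · rw [coeffInt_of_neg g (by omega), mul_zero]
  · obtain ⟨d, hd⟩ := Nat.exists_eq_add_of_le (show (i : ℕ) ≤ k from hik)
    rw [show ((k : ℤ) - i) = (d : ℕ) by omega, coeffInt_natCast, coeff_mul]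
    symm
    refine Finset.sum_of_injOn
      (fun x => if h : (i : ℕ) + x.1 < N then ⟨i + x.1, h⟩ else i) ?_ (by simp) ?_ ?_
    · intro x hx y hy hxy
      simp only [Finset.mem_coe, Finset.HasAntidiagonal.mem_antidiagonal] at hx hy
      have := k.2
      simp only [show (i : ℕ) + x.1 < N by omega, show (i : ℕ) + y.1 < N by omega, dite_true,
        Fin.mk.injEq] at hxy
      ext <;> omega
    · intro j _ hj
      rcases lt_or_ge j i with hji | hji
      · rw [coeffInt_of_neg f (by omega), zero_mul]
      rcases lt_or_ge k j with hkj | hkj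
      · rw [coeffInt_of_neg g (by omega), mul_zero]
      refine absurd ⟨(j - i, k - j), ?_, ?_⟩ hj
      · simp only [Finset.mem_coe, Finset.HasAntidiagonal.mem_antidiagonal]
        omega
      · have hj' : (i : ℕ) + (j - i) = j := by omega
        simp [hj']
    · intro x hx
      rw [Finset.HasAntidiagonal.mem_antidiagonal] at hx
      have := k.2
      simp only [show (i : ℕ) + x.1 < N by omega, dite_true]
      rw [← coeffInt_natCast f, ← coeffInt_natCast g]
      congr 2 <;> push_cast <;> omega

theorem toeplitzMatrix_one (N : ℕ) : toeplitzMatrix N (1 : R⟦X⟧) = 1 := by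
  ext i j
  rw [toeplitzMatrix, Matrix.of_apply, Matrix.one_apply, coeffInt, coeff_one]
  have : i = j ↔ (i : ℕ) = j := Fin.ext_iff
  split_ifs <;> first | rfl | omega

theorem det_toeplitzMatrix (N : ℕ) (f : R⟦X⟧) :
    (toeplitzMatrix N f).det = constantCoeff f ^ N := by
  rw [Matrix.det_of_isUpperTriangular]
  · simp [toeplitzMatrix, coeffInt]
  · intro i j hij
    exact coeffInt_of_neg f (by simp only [id] at hij; omega)

theorem coeff_prod_one_sub {σ : Type*} [Fintype σ] (z : σ → R) (k : ℕ) :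
    coeff k (∏ i, (1 - C (z i) * X)) =
      (-1) ^ k * ∑ s ∈ Finset.powersetCard k (Finset.univ : Finset σ), ∏ i ∈ s, z i := by
  have hprod (s : Finset σ) : ∏ i ∈ s, -(C (z i) * X) =
      C ((-1) ^ s.card * ∏ i ∈ s, z i) * X ^ s.card := by
    rw [Finset.prod_neg, Finset.prod_mul_distrib, Finset.prod_const, map_mul, map_prod, map_pow,
      map_neg, map_one, mul_assoc]
  simp_rw [sub_eq_add_neg, Finset.prod_one_add, hprod, map_sum, coeff_C_mul, coeff_X_pow]
  rw [Finset.powersetCard_eq_filter, Finset.sum_filter, Finset.mul_sum]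
  refine Finset.sum_congr rfl fun s _ => ?_
  by_cases h : s.card = k
  · simp [h]
  · simp [h, Ne.symm h]

/-- The generating function of the complete homogeneous symmetric polynomials. -/
noncomputable def completeHomogeneous {σ : Type*} [Fintype σ] [DecidableEq σ]
    (z : σ → R) : R⟦X⟧ :=
  mk fun n => ∑ m : Sym σ n, (m.1.map z).prod

theorem completeHomogeneous_comp_equiv {σ τ : Type*} [Fintype σ] [DecidableEq σ] [Fintype τ]
    [DecidableEq τ] (e : σ ≃ τ) (z : τ → R) :
    completeHomogeneous (z ∘ e) = completeHomogeneous z := by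
  ext n
  simp only [completeHomogeneous, coeff_mk]
  refine Fintype.sum_equiv (Sym.equivCongr e) _ _ fun m => ?_
  simp [Sym.equivCongr, Sym.map]

theorem one_sub_mul_completeHomogeneous_option {σ : Type*} [Fintype σ] [DecidableEq σ]
    (z : Option σ → R) :
    (1 - C (z none) * X) * completeHomogeneous z = completeHomogeneous fun i => z (some i) := by
  ext n
  rw [sub_mul, one_mul, mul_assoc, map_sub, coeff_C_mul, sub_eq_iff_eq_add]
  cases n with
  | zero => simp [completeHomogeneous, Sym.eq_nil_of_card_zero]
  | succ n =>
    rw [coeff_succ_X_mul]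
    simp only [completeHomogeneous, coeff_mk]
    rw [← Equiv.sum_comp (symOptionSuccEquiv (α := σ) (n := n)).symm, Fintype.sum_sum_type,
      add_comm, Finset.mul_sum]
    congr 1
    · refine Finset.sum_congr rfl fun m _ => ?_
      simp [symOptionSuccEquiv, Sym.map]
    · refine Finset.sum_congr rfl fun m _ => ?_
      simp only [symOptionSuccEquiv, Equiv.coe_fn_symm_mk, SymOptionSuccEquiv.decode_inl]
      exact (congrArg Multiset.prod (Multiset.map_cons z none m.1)).trans (Multiset.prod_cons _ _)

theorem prod_one_sub_mul_completeHomogeneous {σ : Type*} [Fintype σ] [DecidableEq σ]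
    (z : σ → R) : (∏ i, (1 - C (z i) * X)) * completeHomogeneous z = 1 := by
  refine Fintype.induction_empty_option (P := fun σ _ => ∀ [DecidableEq σ] (z : σ → R),
    (∏ i, (1 - C (z i) * X)) * completeHomogeneous z = 1) ?_ ?_ ?_ σ z
  · intro α β _ e ih _ z
    classical
    let _ : Fintype α := Fintype.ofEquiv β e.symm
    rw [← completeHomogeneous_comp_equiv e, ← e.prod_comp fun i => 1 - C (z i) * X]
    exact ih (z ∘ e)
  · intro _ z
    ext n
    cases n with
    | zero => simp [completeHomogeneous, Sym.eq_nil_of_card_zero]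
    | succ n => simp [completeHomogeneous, coeff_one]
  · intro α _ ih _ z
    classical
    rw [Fintype.prod_option, mul_right_comm, mul_comm]
    convert ih fun i => z (some i) using 2
    rw [← one_sub_mul_completeHomogeneous_option]
    congr!

end PowerSeries

open PowerSeries in
theorem aCoeff_eq_mul_coeffInt (w p : ℕ) (ap : ℂ) (z : Fin w → ℂ) (k : ℤ) :
    aCoeff w p ap z k = ap * coeffInt (∏ i, (1 - C (z i) * X)) (p - k) := by
  rcases lt_or_ge ((p : ℤ) - k) 0 with h | h
  · rw [coeffInt_of_neg _ h, aCoeff, eInt, if_neg h.not_ge, mul_zero, mul_zero]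
  · obtain ⟨d, hd⟩ := Int.eq_ofNat_of_zero_le h
    rw [aCoeff, hd, coeffInt_natCast, coeff_prod_one_sub, eInt, if_pos (Int.natCast_nonneg d),
      zpow_natCast, Int.toNat_natCast]
    ring

theorem hInt_eq_coeffInt (w : ℕ) (z : Fin w → ℂ) (k : ℤ) :
    hInt w z k = PowerSeries.coeffInt (PowerSeries.completeHomogeneous z) k := by
  simp [hInt, PowerSeries.coeffInt, PowerSeries.completeHomogeneous]

/-- Theorem 2, formula (eq:adj_through_skew_Schur_Alexandersson):
`adj(T_n(a))_{r,s} = (-1)^{p(n-1)} a_p^{n-1} s_{((n-1)^p, n-r)/(n-s)}`. -/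
theorem toeplitz_adjugate_eq_skewSchur_alexandersson
    (w : ℕ) (hw : 1 ≤ w) (z : Fin w → ℂ) (p : ℕ) (ap : ℂ) (hap : ap ≠ 0)
    (n : ℕ) (hn : 1 ≤ n) (r s : ℕ) (hr : 1 ≤ r) (hrn : r ≤ n) (hs : 1 ≤ s) (hsn : s ≤ n) :
    Matrix.adjugate (toeplitz n (aCoeff w p ap z)) ⟨r - 1, by omega⟩ ⟨s - 1, by omega⟩
      = (-1 : ℂ) ^ (p * (n - 1)) * ap ^ (n - 1)
        * skewSchur w z (p + 1)
            (fun j => if j ≤ p then (n : ℤ) - 1 else (n : ℤ) - (r : ℤ))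
            (fun k => if k = 1 then (n : ℤ) - (s : ℤ) else 0) := by
  set E : PowerSeries ℂ := ∏ i, (1 - PowerSeries.C (z i) * PowerSeries.X)
  set H : PowerSeries ℂ := PowerSeries.completeHomogeneous z with hH
  set row : Fin n ⊕ Fin p ≃ Fin (n + p) := finSumFinEquiv with hrow
  set col : Fin n ⊕ Fin p ≃ Fin (n + p) := row.trans (finRotate (n + p) ^ p) with hcol
  have hrowl (a : Fin n) : (row (Sum.inl a) : ℕ) = a := by simp [hrow]
  have hrowr (i : Fin p) : (row (Sum.inr i) : ℕ) = n + i := by simp [hrow]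
  have hcoll (a : Fin n) : (col (Sum.inl a) : ℕ) = a + p := by
    rw [hcol, Equiv.trans_apply, coe_finRotate_pow_apply, hrowl, Nat.mod_eq_of_lt (by omega)]
  have hcolr (i : Fin p) : (col (Sum.inr i) : ℕ) = i := by
    rw [hcol, Equiv.trans_apply, coe_finRotate_pow_apply, hrowr,
      show n + i + p = i + (n + p) by ring, Nat.add_mod_right, Nat.mod_eq_of_lt (by omega)]
  set M := (PowerSeries.toeplitzMatrix (n + p) E).submatrix row col with hM
  set N := (PowerSeries.toeplitzMatrix (n + p) H).submatrix col row with hN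
  have hMN : M * N = 1 := by
    rw [hM, hN, Matrix.submatrix_mul_equiv, PowerSeries.toeplitzMatrix_mul,
      PowerSeries.prod_one_sub_mul_completeHomogeneous, PowerSeries.toeplitzMatrix_one,
      Matrix.submatrix_one_equiv]
  have hNdet : N.det = (-1) ^ ((n + p - 1) * p) := by
    have : N = ((PowerSeries.toeplitzMatrix (n + p) H).submatrix
        (finRotate (n + p) ^ p : Equiv.Perm _) id).submatrix row row := rfl
    rw [this, Matrix.det_submatrix_equiv_self, Matrix.det_permute,
      PowerSeries.det_toeplitzMatrix, map_pow, sign_finRotate]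
    simp [hH, PowerSeries.completeHomogeneous, Sym.eq_nil_of_card_zero, pow_mul]
  have hT : toeplitz n (aCoeff w p ap z) = ap • M.toBlocks₁₁ := by
    ext a b
    simp only [toeplitz, Matrix.of_apply, Matrix.smul_apply, smul_eq_mul, aCoeff_eq_mul_coeffInt,
      Matrix.toBlocks₁₁, hM, Matrix.submatrix_apply, PowerSeries.toeplitzMatrix, hrowl, hcoll]
    congr 2
    push_cast
    ring
  have hJ := Matrix.adjugate_toBlocks₁₁_mul_det_of_mul_eq_one hMN
    ⟨r - 1, by omega⟩ ⟨s - 1, by omega⟩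
  set J := N.submatrix (fun x : Option (Fin p) => x.elim (Sum.inl ⟨r - 1, by omega⟩) Sum.inr)
    (fun x : Option (Fin p) => x.elim (Sum.inl ⟨s - 1, by omega⟩) Sum.inr) with hJdef
  have hskew : skewSchur w z (p + 1)
      (fun j => if j ≤ p then (n : ℤ) - 1 else (n : ℤ) - (r : ℤ))
      (fun k => if k = 1 then (n : ℤ) - (s : ℤ) else 0) = (-1) ^ p * J.det := by
    rw [← Matrix.det_submatrix_equiv_self (finSuccEquiv p) J, skewSchur]
    have hs' : (-1 : ℂ) ^ p = ((Equiv.Perm.sign (finRotate (p + 1)) : ℤˣ) : ℤ) := by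
      simp [sign_finRotate]
    rw [hs', ← Matrix.det_permute]
    congr 1
    ext j k
    simp only [Matrix.of_apply, Matrix.submatrix_apply, id, hInt_eq_coeffInt, hJdef, hN,
      PowerSeries.toeplitzMatrix]
    congr 1
    induction j using Fin.lastCases with
    | last =>
      rw [finRotate_last, finSuccEquiv_zero]
      cases k using Fin.cases with
      | zero => simp [hcoll, hrowl]; omega
      | succ k => simp [hcoll, hrowr]; omega
    | cast j =>
      rw [finRotate_apply, Fin.coeSucc_eq_succ, finSuccEquiv_succ]
      cases k using Fin.cases with
      | zero => simp [hcolr, hrowl]; omega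
      | succ k => simp [hcolr, hrowr]; omega
  rw [hskew, ← hJ, hNdet, hT, Matrix.adjugate_smul, Matrix.smul_apply, smul_eq_mul,
    Fintype.card_fin]
  obtain ⟨n, rfl⟩ := Nat.exists_eq_add_of_le' hn
  have hsign : (-1 : ℂ) ^ (p * n) * ((-1) ^ p * (-1) ^ ((n + p) * p)) = 1 := by
    rw [← pow_add, ← pow_add]
    refine Even.neg_one_pow ?_
    rw [show p * n + (p + (n + p) * p) = 2 * (p * n) + p * (p + 1) by ring]
    exact (even_two_mul _).add (Nat.even_mul_succ_self p)
  simp only [show n + 1 + p - 1 = n + p by omega, Nat.add_sub_cancel]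
  linear_combination (-(ap ^ n * M.toBlocks₁₁.adjugate ⟨r - 1, by omega⟩ ⟨s - 1, by omega⟩)) * hsign
end

section
/- Let w ≥ 1, p ≥ 1, n ≥ 1, let a_p,…,a_{p−w} be complex numbers with a_p ≠ 0 defining the Laurent polynomial a(t) = Σ_{k=p−w}^p a_k t^k and the n×n banded Toeplitz matrix T_n(a) = [a_{j−k}]_{j,k=1}^n, and let x ∈ ℂ be an eigenvalue of T_n(a). Let z_1,…,z_w be the zeros (with multiplicity) of a − x, i.e. a(t) − x = a_p t^{p−w} ∏_{j=1}^w (t − z_j). Then the vector v ∈ ℂ^n with components v_r = s_{((n−1)^{p−1}, n−r)}(z_1,…,z_w) for r = 1,…,n satisfies T_n(a) v = x v, where ((n−1)^{p−1}, n−r) is the partition with n−1 repeated p−1 times followed by the part n−r. -/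
open scoped BigOperators

open PowerSeries in
/-- The generating series `∑ hₙ tⁿ` of the complete homogeneous symmetric polynomials. -/
theorem mk_hInt_eq_prod (w : ℕ) (z : Fin w → ℂ) :
    (mk fun n : ℕ => hInt w z n) = ∏ i, mk fun n : ℕ => z i ^ n := by
  ext n
  have : Fintype {P : Fin w →₀ ℕ // P.sum (fun _ => id) = n} :=
    Fintype.ofEquiv _ (Sym.equivNatSum (Fin w) n)
  rw [coeff_prod, coeff_mk, hInt, if_pos (Int.natCast_nonneg n), Int.toNat_natCast,
    ← Equiv.sum_comp (Sym.equivNatSum (Fin w) n).symm,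
    Finset.sum_subtype (p := fun P : Fin w →₀ ℕ => P.sum (fun _ => id) = n)]
  · refine Finset.sum_congr rfl fun P _ => ?_
    have h := Sym.coe_equivNatSum_symm_apply (α := Fin w) (n := n) P
    change (Multiset.map z ((Sym.equivNatSum (Fin w) n).symm P : Multiset (Fin w))).prod = _
    rw [h, Finsupp.toMultiset_map, Finsupp.prod_toMultiset, Finsupp.prod_mapDomain_index (by simp)
      (by intros; rw [pow_add]), Finsupp.prod_fintype _ _ (by simp)]
    simp
  · intro P
    simp [Finset.mem_finsuppAntidiag, Finsupp.sum_fintype]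

open PowerSeries in
/-- The generating series `∑ (-1)ⁿ eₙ tⁿ` of the signed elementary symmetric polynomials. -/
theorem mk_eInt_eq_prod (w : ℕ) (z : Fin w → ℂ) :
    (mk fun n : ℕ => (-1) ^ n * eInt w z n) = ∏ i, (1 - C (z i) * X) := by
  simp_rw [sub_eq_add_neg]
  rw [Finset.prod_one_add]
  ext n
  rw [map_sum, coeff_mk, eInt, if_pos (Int.natCast_nonneg n), Int.toNat_natCast,
    Finset.powersetCard_eq_filter, Finset.sum_filter, Finset.mul_sum]
  refine Finset.sum_congr rfl fun s _ => ?_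
  have h : ∏ i ∈ s, -(C (z i) * X) = C ((-1) ^ s.card * ∏ i ∈ s, z i) * (X : ℂ⟦X⟧) ^ s.card := by
    rw [Finset.prod_neg, Finset.prod_mul_distrib, Finset.prod_const]
    simp [mul_assoc]
  rw [h, coeff_C_mul_X_pow]
  by_cases hs : s.card = n
  · simp [hs]
  · simp [hs, Ne.symm hs]

open PowerSeries in
theorem mk_eInt_mul_mk_hInt (w : ℕ) (z : Fin w → ℂ) :
    (mk fun n : ℕ => (-1) ^ n * eInt w z n) * (mk fun n : ℕ => hInt w z n) = 1 := by
  rw [mk_eInt_eq_prod, mk_hInt_eq_prod, ← Finset.prod_mul_distrib]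
  refine Finset.prod_eq_one fun i _ => ?_
  have h := congrArg (rescale (z i)) (mk_one_mul_one_sub_eq_one ℂ)
  rw [mul_comm]
  simpa [rescale_mk, rescale_X] using h

open PowerSeries in
theorem sum_range_convolution_eq_zero {R : Type*} [CommRing R] {c h : ℤ → R}
    (hh : ∀ m < 0, h m = 0)
    (H : (mk fun n : ℕ => c n) * (mk fun n : ℕ => h n) = 1)
    {N L : ℕ} (hN : 0 < N) (hL : N < L) :
    ∑ m ∈ Finset.range L, c m * h ((N : ℤ) - m) = 0 := by
  have h1 := congrArg (coeff N) H
  rw [coeff_mul, Finset.Nat.sum_antidiagonal_eq_sum_range_succ_mk, coeff_one,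
    if_neg hN.ne'] at h1
  rw [← h1]
  symm
  calc _ = ∑ m ∈ Finset.range (N + 1), c m * h ((N : ℤ) - m) := by
        refine Finset.sum_congr rfl fun m hm => ?_
        have : m ≤ N := by simpa [Nat.lt_succ_iff] using hm
        simp [Nat.cast_sub this]
    _ = _ := by
        refine Finset.sum_subset (Finset.range_mono hL) fun m _ hm => ?_
        rw [hh _ (by simp at hm; omega), mul_zero]

theorem sum_range_shifted_convolution_eq_zero {R : Type*} [CommRing R] {c h : ℤ → R}
    (hc : ∀ m < 0, c m = 0) (hh : ∀ m < 0, h m = 0)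
    (H : (PowerSeries.mk fun n : ℕ => c n) * (PowerSeries.mk fun n : ℕ => h n) = 1)
    {p n i k : ℕ} (hi : i < n) (hk : k < p) :
    ∑ q ∈ Finset.range (p + n), c ((q : ℤ) - i) * h ((n : ℤ) - q + k) = 0 := by
  obtain ⟨L, rfl⟩ : ∃ L, n = i + L := ⟨n - i, by omega⟩
  rw [show p + (i + L) = i + (p + L) by ring, Finset.sum_range_add, Finset.sum_eq_zero, zero_add,
    ← sum_range_convolution_eq_zero (N := L + k) (L := p + L) hh H (by omega) (by omega)]
  · refine Finset.sum_congr rfl fun m _ => ?_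
    push_cast
    congr 2 <;> ring
  · intro q hq
    rw [hc _ (by simp at hq; omega), zero_mul]

open PowerSeries in
/-- The duality between the Toeplitz determinants `det [c_{p+i-r}]_{n×n}` and
`det [h_{n-j+k}]_{p×p}` for mutually inverse power series: if the former is singular then so is
the latter. -/
theorem det_eq_zero_of_inverse_series {K : Type*} [Field K] {c h : ℤ → K}
    (hc : ∀ m < 0, c m = 0) (hh : ∀ m < 0, h m = 0)
    (H : (mk fun n : ℕ => c n) * (mk fun n : ℕ => h n) = 1) {p n : ℕ}
    {u : Fin n → K} (hu : u ≠ 0)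
    (hcu : ∀ i < n, ∑ r : Fin n, c ((p : ℤ) - i + r) * u r = 0) :
    Matrix.det (Matrix.of fun j k : Fin p => h ((n : ℤ) - j + k)) = 0 := by
  set U : K⟦X⟧ := ∑ r : Fin n, C (u r) * X ^ (n - 1 - (r : ℕ)) with hU
  set F : K⟦X⟧ := U * mk fun n : ℕ => c n with hF
  have hUF : U = F * mk fun n : ℕ => h n := by rw [hF, mul_assoc, H, mul_one]
  have hUcoeff : ∀ N, coeff N U = ∑ r : Fin n, if N = n - 1 - (r : ℕ) then u r else 0 := by
    intro N
    simp [hU, coeff_C_mul, coeff_X_pow]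
  have hF0 : ∀ N, p ≤ N → N < p + n → coeff N F = 0 := by
    intro N h1 h2
    rw [← hcu (p + n - 1 - N) (by omega), hF, hU, Finset.sum_mul, map_sum]
    refine Finset.sum_congr rfl fun r _ => ?_
    rw [mul_assoc, coeff_C_mul, coeff_X_pow_mul', mul_comm]
    have := r.2
    split_ifs with h3
    · rw [coeff_mk]
      congr 2
      omega
    · rw [hc _ (by omega), zero_mul]
  rw [← Matrix.exists_vecMul_eq_zero_iff]
  refine ⟨fun s => coeff s F, ?_, ?_⟩
  · intro hV
    have hF1 : ∀ N, N < p + n → coeff N F = 0 := by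
      intro N hN
      by_cases h1 : p ≤ N
      · exact hF0 N h1 hN
      · exact congrFun hV ⟨N, by omega⟩
    refine hu (funext fun r => ?_)
    have hr := r.2
    have h1 : coeff (n - 1 - (r : ℕ)) U = 0 := by
      rw [hUF, coeff_mul]
      refine Finset.sum_eq_zero fun x hx => ?_
      rw [Finset.HasAntidiagonal.mem_antidiagonal] at hx
      rw [hF1 _ (by omega), zero_mul]
    rw [hUcoeff, Finset.sum_eq_single r, if_pos rfl] at h1
    · exact h1
    · intro b _ hb
      have := b.2
      rw [if_neg]
      intro h2
      exact hb (Fin.ext (by omega))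
    · simp
  · ext k
    have hk := k.2
    have h1 : coeff (n + k) U = 0 := by
      rw [hUcoeff]
      refine Finset.sum_eq_zero fun r _ => if_neg ?_
      have := r.2
      omega
    rw [hUF, coeff_mul, Finset.Nat.sum_antidiagonal_eq_sum_range_succ_mk] at h1
    rw [Pi.zero_apply, ← h1, Matrix.vecMul, dotProduct]
    simp only [Matrix.of_apply, coeff_mk]
    rw [Fin.sum_univ_eq_sum_range (fun s => coeff s F * h ((n : ℤ) - s + k)) p]
    calc _ = ∑ s ∈ Finset.range (p + n), coeff s F * h ((n : ℤ) - s + k) := by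
          refine Finset.sum_subset (Finset.range_mono (by omega)) fun s hs hs' => ?_
          rw [hF0 s (by simpa using hs') (by simpa using hs), zero_mul]
      _ = ∑ s ∈ Finset.range (n + k + 1), coeff s F * h ((n : ℤ) - s + k) := by
          refine (Finset.sum_subset (Finset.range_mono (by omega)) fun s _ hs => ?_).symm
          rw [hh _ (by simp at hs; omega), mul_zero]
      _ = _ := by
          refine Finset.sum_congr rfl fun s hs => ?_
          have hs' : s ≤ n + k := by simpa [Nat.lt_succ_iff] using hs
          congr 2
          omega

/-- Cyclically moving the first row of a matrix to the last place preserves singularity. -/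
theorem det_updateRow_last_eq_zero {R : Type*} [CommRing R] {P : ℕ}
    (G : ℕ → Fin (P + 1) → R) (h : Matrix.det (Matrix.of fun j : Fin (P + 1) => G j) = 0) :
    ((Matrix.of fun j : Fin (P + 1) => G (j + 1)).updateRow (Fin.last P) (G 0)).det = 0 := by
  have h1 := Matrix.det_permute (finRotate (P + 1)) (Matrix.of fun j : Fin (P + 1) => G j)
  rw [h, mul_zero] at h1
  rw [← h1]
  congr 1
  ext j k
  induction j using Fin.lastCases with
  | last => simp
  | cast j =>
    rw [Matrix.updateRow_ne (Fin.castSucc_lt_last j).ne]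
    simp

theorem aCoeff_eq (w p : ℕ) (ap : ℂ) (z : Fin w → ℂ) (k : ℤ) :
    aCoeff w p ap z k = ap * ((-1) ^ ((p : ℤ) - k) * eInt w z ((p : ℤ) - k)) := by
  rw [aCoeff]; ring

/-- Theorem 3, formula (eq:eigvec_components): if `x` is an eigenvalue of `T_n(a)` and
`z_1,…,z_w` are the zeros of `a - x`, then the vector with components
`v_r = s_{((n-1)^{p-1}, n-r)}(z_1,…,z_w)` satisfies `T_n(a) v = x v`. -/
theorem toeplitz_eigenvector
    (w p n : ℕ) (hw : 1 ≤ w) (hp : 1 ≤ p) (hn : 1 ≤ n)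
    (a : ℤ → ℂ)
    (hband : ∀ k : ℤ, ((p : ℤ) < k ∨ k < (p : ℤ) - (w : ℤ)) → a k = 0)
    (hap : a (p : ℤ) ≠ 0)
    (x : ℂ)
    (hx : Matrix.det (toeplitz n a - x • (1 : Matrix (Fin n) (Fin n) ℂ)) = 0)
    (z : Fin w → ℂ)
    (hz : ∀ k : ℤ, a k - (if k = 0 then x else 0) = aCoeff w p (a (p : ℤ)) z k) :
    Matrix.mulVec (toeplitz n a)
        (fun r : Fin n => schur w z p
          (fun j => if j ≤ p - 1 then (n : ℤ) - 1 else (n : ℤ) - ((r.1 : ℤ) + 1)))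
      = x • (fun r : Fin n => schur w z p
          (fun j => if j ≤ p - 1 then (n : ℤ) - 1 else (n : ℤ) - ((r.1 : ℤ) + 1))) := by
  obtain ⟨P, rfl⟩ : ∃ P, p = P + 1 := ⟨p - 1, by omega⟩
  set c : ℤ → ℂ := fun m => (-1) ^ m * eInt w z m with hcdef
  set h : ℤ → ℂ := hInt w z with hhdef
  have hc : ∀ m < 0, c m = 0 := fun m hm => by simp [hcdef, eInt, not_le.2 hm]
  have hh : ∀ m < 0, h m = 0 := fun m hm => by simp [hhdef, hInt, not_le.2 hm]
  have H : (PowerSeries.mk fun n : ℕ => c n) * (PowerSeries.mk fun n : ℕ => h n) = 1 := by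
    simpa [hcdef, hhdef] using mk_eInt_mul_mk_hInt w z
  set B := toeplitz n a - x • (1 : Matrix (Fin n) (Fin n) ℂ) with hB
  have hBc : ∀ i r : Fin n, B i r = a ((P + 1 : ℕ) : ℤ) * c (((P + 1 : ℕ) : ℤ) - i + r) := by
    intro i r
    have h1 := hz ((i : ℤ) - r)
    rw [aCoeff_eq, show ((P + 1 : ℕ) : ℤ) - ((i : ℤ) - r) = ((P + 1 : ℕ) : ℤ) - i + r by ring] at h1
    rw [← h1]
    have h2 : ((i : ℤ) - r = 0) ↔ i = r := by rw [Fin.ext_iff]; omega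
    simp [hB, toeplitz, Matrix.one_apply, h2]
  obtain ⟨u, hu, hBu⟩ := Matrix.exists_mulVec_eq_zero_iff.2 hx
  set G : ℕ → Fin (P + 1) → ℂ := fun q k => h ((n : ℤ) - q + k) with hG
  have hdet : Matrix.det (Matrix.of fun j : Fin (P + 1) => G j) = 0 := by
    refine det_eq_zero_of_inverse_series (p := P + 1) hc hh H hu fun i hi => ?_
    have h1 := congrFun hBu ⟨i, hi⟩
    simp only [Matrix.mulVec, dotProduct, hBc, mul_assoc, ← Finset.mul_sum] at h1
    exact (mul_eq_zero.1 h1).resolve_left hap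
  set M : Matrix (Fin (P + 1)) (Fin (P + 1)) ℂ := Matrix.of fun j => G (j + 1) with hM
  set D : (Fin (P + 1) → ℂ) →ₗ[ℂ] ℂ := LinearMap.proj (Fin.last P) ∘ₗ Matrix.cramer M.transpose
    with hDdef
  have hD : ∀ b, D b = (M.updateRow (Fin.last P) b).det := fun b =>
    Matrix.cramer_transpose_apply M b (Fin.last P)
  have hv : (fun r : Fin n => schur w z (P + 1)
      (fun j => if j ≤ P + 1 - 1 then (n : ℤ) - 1 else (n : ℤ) - ((r.1 : ℤ) + 1)))
      = fun r : Fin n => D (G (P + 1 + r)) := by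
    funext r
    rw [hD, schur, skewSchur]
    congr 1
    ext j k
    induction j using Fin.lastCases with
    | last =>
      rw [Matrix.updateRow_self]
      simp [hG, hhdef]
      congr 1
      ring
    | cast j =>
      rw [Matrix.updateRow_ne (Fin.castSucc_lt_last j).ne]
      have := j.2
      simp [hG, hM, hhdef]
      congr 1
      ring
  rw [hv]
  have hDG : ∀ q < P, D (G (q + 1)) = 0 := by
    intro q hq
    rw [hD]
    exact Matrix.det_updateRow_eq_zero (M := M) (i := ⟨q, by omega⟩) (j := Fin.last P)
      (Fin.ne_of_lt hq)
  have hDG0 : D (G 0) = 0 := by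
    rw [hD]
    exact det_updateRow_last_eq_zero G hdet
  have key : B.mulVec (fun r : Fin n => D (G (P + 1 + r))) = 0 := by
    funext i
    simp only [Matrix.mulVec, dotProduct, hBc, mul_assoc, ← Finset.mul_sum, Pi.zero_apply]
    have h1 : ∑ q ∈ Finset.range (P + 1 + n), c ((q : ℤ) - i) • G q = 0 := by
      funext k
      simpa [hG] using sum_range_shifted_convolution_eq_zero hc hh H i.2 k.2
    have h2 := congrArg D h1
    rw [map_sum, map_zero, Finset.sum_range_add, Finset.sum_eq_zero, zero_add,
      ← Fin.sum_univ_eq_sum_range (fun r => D (c (((P + 1 + r : ℕ) : ℤ) - i) • G (P + 1 + r)))] at h2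
    · rw [mul_eq_zero]
      right
      rw [← h2]
      refine Finset.sum_congr rfl fun r _ => ?_
      rw [map_smul, smul_eq_mul]
      congr 2
      push_cast
      ring
    · intro q hq
      rw [map_smul]
      rcases q with _ | q
      · rw [hDG0, smul_zero]
      · rw [hDG q (by simpa using hq), smul_zero]
  rw [hB, Matrix.sub_mulVec, Matrix.smul_mulVec, Matrix.one_mulVec, sub_eq_zero] at key
  exact key
end
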